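/- Let m, n be positive integers and ρ a faithful positive linear functional on M_n(ℂ). Every x ∈ K_{m,ρ} ∖ {0} is represented by a Borel probability measure M_x on K_{m,ρ} in the following sense: (i) for every continuous real-linear functional f on the product space ∏_{l≥0} M_m(ℂ)⊗M_n(ℂ)^{⊗l} one has f(x) = ∫ f dM_x; (ii) M_x(F) = 1 for every closed subset F of K_{m,ρ} containing exr(K_{m,ρ}). (Proposition 3.2 of the paper.) -/

import Mathlib

open scoped ComplexOrder

namespace DeFinetti

/-- `M_m(ℂ) ⊗ M_n(ℂ)^{⊗ l}`, realized as complex matrices indexed by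
`Fin m × (Fin l → Fin n)`. -/
abbrev Mat (m n l : ℕ) : Type :=
  Matrix (Fin m × (Fin l → Fin n)) (Fin m × (Fin l → Fin n)) ℂ

/-- Invariance under the action of `S_l` simultaneously permuting the `l`
tensor-factor positions of row and column indices. -/
def SymInvariant {m n l : ℕ} (x : Mat m n l) : Prop :=
  ∀ σ : Equiv.Perm (Fin l), ∀ p q : Fin m, ∀ i j : Fin l → Fin n,
    x (p, i ∘ σ) (q, j ∘ σ) = x (p, i) (q, j)

/-- The slice map `id_m ⊗ id_n^{⊗l} ⊗ ν` applying the functional `ν` to the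
last tensor factor. -/
def sliceMap {m n l : ℕ} (ν : Matrix (Fin n) (Fin n) ℂ →ₗ[ℂ] ℂ)
    (y : Mat m n (l + 1)) : Mat m n l :=
  fun pi qj =>
    ν (Matrix.of fun s t => y (pi.1, Fin.snoc pi.2 s) (qj.1, Fin.snoc qj.2 t))

/-- A positive linear functional on `M_n(ℂ)`. -/
def IsPosLF {n : ℕ} (ρ : Matrix (Fin n) (Fin n) ℂ →ₗ[ℂ] ℂ) : Prop :=
  ∀ x : Matrix (Fin n) (Fin n) ℂ, x.PosSemidef → 0 ≤ ρ x

/-- A faithful positive linear functional on `M_n(ℂ)`. -/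
def IsFaithfulPosLF {n : ℕ} (ρ : Matrix (Fin n) (Fin n) ℂ →ₗ[ℂ] ℂ) : Prop :=
  IsPosLF ρ ∧ ∀ x : Matrix (Fin n) (Fin n) ℂ, x.PosSemidef → x ≠ 0 → 0 < ρ x

/-- The convex cone `K_{m,ρ}` of sub-martingale sequences of symmetric quantum
states. -/
def Kcone (m n : ℕ) (ρ : Matrix (Fin n) (Fin n) ℂ →ₗ[ℂ] ℂ) :
    Set (∀ l : ℕ, Mat m n l) :=
  { x | (∀ l, (x l).PosSemidef) ∧ (∀ l, SymInvariant (x l)) ∧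
        ∀ l, (x l - sliceMap ρ (x (l + 1))).PosSemidef }

section ExtremeRays

variable {E : Type*} [AddCommGroup E] [Module ℝ E]

/-- `x` lies on the ray `ℝ≥0 • v`. -/
def OnRay (v x : E) : Prop := ∃ r : ℝ, 0 ≤ r ∧ x = r • v

/-- `v` generates an extreme ray of the convex cone `K`. -/
def IsExtremeRayGen (K : Set E) (v : E) : Prop :=
  v ∈ K ∧ v ≠ 0 ∧
    ∀ x : E, OnRay v x → x ≠ 0 →
      ∀ y ∈ K, ∀ z ∈ K, ∀ t : ℝ, 0 < t → t < 1 →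
        x = t • y + (1 - t) • z → OnRay v y ∧ OnRay v z

/-- `exr K`: the union of the extreme rays of `K`. -/
def exr (K : Set E) : Set E := { x | ∃ v : E, IsExtremeRayGen K v ∧ OnRay v x }

end ExtremeRays

/-- The Kronecker product `a ⊗ b^{⊗ l}`. -/
def kronPow {m n : ℕ} (a : Matrix (Fin m) (Fin m) ℂ) (b : Matrix (Fin n) (Fin n) ℂ)
    (l : ℕ) : Mat m n l :=
  fun pi qj => a pi.1 qj.1 * ∏ k : Fin l, b (pi.2 k) (qj.2 k)

/-- The tensor power functional `ρ^{⊗ k}`, obtained by iterating the slice of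
the last factor. -/
def powFun {n : ℕ} (ρ : Matrix (Fin n) (Fin n) ℂ →ₗ[ℂ] ℂ) :
    (k : ℕ) → Matrix (Fin k → Fin n) (Fin k → Fin n) ℂ → ℂ
  | 0, z => z (fun i => i.elim0) (fun i => i.elim0)
  | k + 1, z => powFun ρ k (Matrix.of fun i j =>
      ρ (Matrix.of fun s t => z (Fin.snoc i s) (Fin.snoc j t)))

/-- `(id_m ⊗ id_n ⊗ ρ^{⊗ k})(y)` for `y ∈ M_m(ℂ) ⊗ M_n(ℂ)^{⊗ (k+1)}`,
applying `ρ^{⊗ k}` to the last `k` tensor factors. -/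
def subSlice {m n : ℕ} (ρ : Matrix (Fin n) (Fin n) ℂ →ₗ[ℂ] ℂ) {k : ℕ}
    (y : Mat m n (k + 1)) : Matrix (Fin m × Fin n) (Fin m × Fin n) ℂ :=
  fun ps qt => powFun ρ k (Matrix.of fun i j =>
    y (ps.1, Fin.cons ps.2 i) (qt.1, Fin.cons qt.2 j))

/-- `y` is an `(k+1)`-sub-extension of `a` with respect to `ρ`. -/
def IsSubExtension {m n : ℕ} (ρ : Matrix (Fin n) (Fin n) ℂ →ₗ[ℂ] ℂ)
    (a : Matrix (Fin m × Fin n) (Fin m × Fin n) ℂ) {k : ℕ}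
    (y : Mat m n (k + 1)) : Prop :=
  y.PosSemidef ∧ SymInvariant y ∧ (a - subSlice ρ y).PosSemidef

/-- Separability: `a` is a finite sum of Kronecker products of positive
semidefinite matrices. -/
def IsSeparable {m n : ℕ} (a : Matrix (Fin m × Fin n) (Fin m × Fin n) ℂ) : Prop :=
  ∃ (N : ℕ) (b : Fin N → Matrix (Fin m) (Fin m) ℂ)
    (c : Fin N → Matrix (Fin n) (Fin n) ℂ),
    (∀ i, (b i).PosSemidef) ∧ (∀ i, (c i).PosSemidef) ∧
    a = ∑ i, Matrix.kroneckerMap (· * ·) (b i) (c i)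


noncomputable instance {m n l : ℕ} : MeasurableSpace (Mat m n l) := borel _

section ChoquetTheory

open MeasureTheory

variable {E : Type*} [AddCommGroup E] [Module ℝ E] [TopologicalSpace E]

/-- The probability measures on a compact set `C` represent a closed set of points. -/
theorem isClosed_setOf_represented [T2Space E] [MeasurableSpace E] [BorelSpace E]
    {C : Set E} (hC : IsCompact C) :
    IsClosed {y : E | ∃ ν : ProbabilityMeasure C,
      ∀ f : E →L[ℝ] ℝ, ∫ z, f z ∂(ν : Measure C) = f y} := by
  have : CompactSpace C := isCompact_iff_compactSpace.mp hC
  have hclosed : IsClosed {p : ProbabilityMeasure C × E |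
      ∀ f : E →L[ℝ] ℝ, ∫ z, f z ∂(p.1 : Measure C) = f p.2} := by
    rw [Set.ofPred_forall]
    refine isClosed_iInter fun f => isClosed_eq ?_ (f.continuous.comp continuous_snd)
    exact (ProbabilityMeasure.continuous_integral_boundedContinuousFunction
      (BoundedContinuousFunction.mkOfCompact
        ⟨fun z : C => f z, f.continuous.comp continuous_subtype_val⟩)).comp continuous_fst
  convert! isClosedMap_snd_of_compactSpace _ hclosed using 1
  ext y
  simp

/-- The probability measures on a compact set `C` represent a convex set of points. -/
theorem convex_setOf_represented [T2Space E] [MeasurableSpace E] [BorelSpace E]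
    {C : Set E} (hC : IsCompact C) :
    Convex ℝ {y : E | ∃ ν : ProbabilityMeasure C,
      ∀ f : E →L[ℝ] ℝ, ∫ z, f z ∂(ν : Measure C) = f y} := by
  have : CompactSpace C := isCompact_iff_compactSpace.mp hC
  rintro y ⟨ν, hν⟩ z ⟨ξ, hξ⟩ a b ha hb hab
  have hprob : IsProbabilityMeasure
      (ENNReal.ofReal a • (ν : Measure C) + ENNReal.ofReal b • (ξ : Measure C)) := by
    refine ⟨?_⟩
    simp [← ENNReal.ofReal_add ha hb, hab]
  refine ⟨⟨_, hprob⟩, fun f => ?_⟩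
  have hint (κ : Measure C) [IsFiniteMeasure κ] : Integrable (fun z : C => f z) κ :=
    (BoundedContinuousFunction.mkOfCompact
      ⟨fun z : C => f z, f.continuous.comp continuous_subtype_val⟩).integrable κ
  rw [ProbabilityMeasure.coe_mk, integral_add_measure
    ((hint _).smul_measure ENNReal.ofReal_ne_top) ((hint _).smul_measure ENNReal.ofReal_ne_top),
    integral_smul_measure, integral_smul_measure, hν, hξ]
  simp [ENNReal.toReal_ofReal ha, ENNReal.toReal_ofReal hb]

/-- Every point of a compact convex set is represented by a probability measure carried by the
closure of the set of extreme points. -/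
theorem exists_representing_measure [T2Space E] [IsTopologicalAddGroup E] [ContinuousSMul ℝ E]
    [LocallyConvexSpace ℝ E] [MeasurableSpace E] [BorelSpace E] {B : Set E}
    (hB : IsCompact B) (hconv : Convex ℝ B) {x : E} (hx : x ∈ B) :
    ∃ μ : Measure E, IsProbabilityMeasure μ ∧ (∀ f : E →L[ℝ] ℝ, f x = ∫ y, f y ∂μ) ∧
      μ (closure (B.extremePoints ℝ)) = 1 := by
  have hC : IsCompact (closure (B.extremePoints ℝ)) :=
    hB.closure_of_subset extremePoints_subset
  have hsub : B ⊆ {y : E | ∃ ν : ProbabilityMeasure (closure (B.extremePoints ℝ)),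
      ∀ f : E →L[ℝ] ℝ, ∫ z, f z ∂(ν : Measure (closure (B.extremePoints ℝ))) = f y} := by
    refine (closure_convexHull_extremePoints hB hconv).symm.subset.trans <| closure_minimal
      (convexHull_min (fun y hy => ?_) (convex_setOf_represented hC))
      (isClosed_setOf_represented hC)
    refine ⟨⟨Measure.dirac ⟨y, subset_closure hy⟩, inferInstance⟩, fun f => ?_⟩
    rw [ProbabilityMeasure.coe_mk, integral_dirac]
  obtain ⟨ν, hν⟩ := hsub hx
  have hemb : MeasurableEmbedding (Subtype.val : closure (B.extremePoints ℝ) → E) :=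
    .subtype_coe isClosed_closure.measurableSet
  refine ⟨(ν : Measure _).map Subtype.val,
    Measure.isProbabilityMeasure_map hemb.measurable.aemeasurable, fun f => ?_, ?_⟩
  · rw [hemb.integral_map, hν]
  · rw [hemb.map_apply, Subtype.coe_preimage_self, measure_univ]

/-- The extreme points of a slice `{y ∈ K | τ y = c}` of a cone lie on extreme rays, when `τ` is
positive on the nonzero elements of the cone. -/
theorem extremePoints_slice_subset_exr {E : Type*} [AddCommGroup E] [Module ℝ E] {K : Set E}
    (hsmul : ∀ y ∈ K, ∀ r : ℝ, 0 ≤ r → r • y ∈ K) (τ : E →ₗ[ℝ] ℝ)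
    (hτ : ∀ y ∈ K, y ≠ 0 → 0 < τ y) {c : ℝ} (hc : 0 < c) :
    {y | y ∈ K ∧ τ y = c}.extremePoints ℝ ⊆ exr K := by
  intro v hv
  obtain ⟨⟨hvK, hvc⟩, hext⟩ := mem_extremePoints.mp hv
  refine ⟨v, ⟨hvK, ?_, ?_⟩, 1, zero_le_one, (one_smul ℝ v).symm⟩
  · rintro rfl
    simp [hc.ne] at hvc
  rintro _ ⟨r, hr, rfl⟩ hx y hy z hz t ht ht1 h
  have hr : 0 < r := hr.lt_of_ne (by rintro rfl; simp at hx)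
  have hzero : OnRay v 0 := ⟨0, le_rfl, (zero_smul ℝ v).symm⟩
  have hray {s : ℝ} (hs : 0 < s) {w : E} (hw : r • v = s • w) : OnRay v w :=
    ⟨s⁻¹ * r, by positivity, by rw [mul_smul, hw, inv_smul_smul₀ hs.ne']⟩
  rcases eq_or_ne y 0 with rfl | hy0
  · exact ⟨hzero, hray (sub_pos.mpr ht1) (by simpa using h)⟩
  rcases eq_or_ne z 0 with rfl | hz0
  · exact ⟨hray ht (by simpa using h), hzero⟩
  have hτy := hτ y hy hy0
  have hτz := hτ z hz hz0
  have hsum : r * c = t * τ y + (1 - t) * τ z := by simpa [hvc] using congrArg τ h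
  have h1t : 0 < 1 - t := sub_pos.mpr ht1
  obtain ⟨h1, h2⟩ := hext ((c / τ y) • y) ⟨hsmul y hy _ (by positivity), by simp [hτy.ne']⟩
    ((c / τ z) • z) ⟨hsmul z hz _ (by positivity), by simp [hτz.ne']⟩
    ⟨t * τ y / (r * c), (1 - t) * τ z / (r * c), by positivity, by positivity,
      by rw [← add_div, ← hsum, div_self (by positivity)], by
        rw [smul_smul, smul_smul,
          show t * τ y / (r * c) * (c / τ y) = r⁻¹ * t by field_simp,
          show (1 - t) * τ z / (r * c) * (c / τ z) = r⁻¹ * (1 - t) by field_simp,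
          mul_smul, mul_smul, ← smul_add, ← h, inv_smul_smul₀ hr.ne']⟩
  refine ⟨⟨τ y / c, by positivity, ?_⟩, ⟨τ z / c, by positivity, ?_⟩⟩
  · rw [← h1, smul_smul, show τ y / c * (c / τ y) = 1 by field_simp, one_smul]
  · rw [← h2, smul_smul, show τ z / c * (c / τ z) = 1 by field_simp, one_smul]

end ChoquetTheory

section PosSemidef

open Matrix

variable {ι : Type*}

theorem norm_entry_le_re_trace [Fintype ι] {A : Matrix ι ι ℂ} (hA : A.PosSemidef) (i j : ι) :
    ‖A i j‖ ≤ A.trace.re := by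
  have hdiag (k : ι) : 0 ≤ (A k k).re := (Complex.nonneg_iff.mp hA.diag_nonneg).1
  have hle (k : ι) : (A k k).re ≤ A.trace.re := by
    rw [Matrix.trace, Complex.re_sum]
    exact Finset.single_le_sum (f := fun k => (A k k).re) (fun k _ => hdiag k) (Finset.mem_univ k)
  have hdet := (hA.submatrix ![i, j]).det_nonneg
  have hherm : A j i = star (A i j) := (hA.isHermitian.apply j i).symm
  have hi := (Complex.nonneg_iff.mp (hA.diag_nonneg (i := i))).2
  rw [Matrix.det_fin_two] at hdet
  simp only [Matrix.submatrix_apply, Matrix.cons_val_zero, Matrix.cons_val_one, hherm,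
    Complex.star_def, Complex.mul_conj] at hdet
  have hre := (Complex.nonneg_iff.mp hdet).1
  simp only [Complex.sub_re, Complex.mul_re, ← hi, zero_mul, sub_zero, Complex.ofReal_re,
    Complex.normSq_eq_norm_sq] at hre
  refine le_of_sq_le_sq ?_ ((hdiag i).trans (hle i))
  nlinarith [mul_le_mul (hle i) (hle j) (hdiag j) ((hdiag i).trans (hle i))]

theorem isClosed_setOf_posSemidef [Fintype ι] : IsClosed {A : Matrix ι ι ℂ | A.PosSemidef} := by
  simp only [posSemidef_iff_dotProduct_mulVec, Matrix.IsHermitian, Set.ofPred_and,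
    Set.ofPred_forall]
  refine IsClosed.inter (isClosed_eq (by fun_prop) continuous_id) ?_
  exact isClosed_iInter fun x => isClosed_le continuous_const (by fun_prop)

theorem isCompact_setOf_norm_entry_le (R : ℝ) :
    IsCompact {A : Matrix ι ι ℂ | ∀ i j, ‖A i j‖ ≤ R} := by
  have h : IsCompact (Set.univ.pi fun _ : ι => Set.univ.pi fun _ : ι =>
      Metric.closedBall (0 : ℂ) R) :=
    isCompact_univ_pi fun _ => isCompact_univ_pi fun _ => isCompact_closedBall _ _
  convert! h using 1
  ext A
  simp only [Set.mem_ofPred_eq, Set.pi, Set.mem_univ, true_imp_iff, mem_closedBall_zero_iff]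
  rfl

end PosSemidef

/-- A faithful positive functional dominates a positive multiple of the trace. -/
theorem exists_mul_re_trace_le {n : ℕ} {ρ : Matrix (Fin n) (Fin n) ℂ →ₗ[ℂ] ℂ}
    (hρ : IsFaithfulPosLF ρ) :
    ∃ c : ℝ, 0 < c ∧ ∀ a : Matrix (Fin n) (Fin n) ℂ, a.PosSemidef →
      c * a.trace.re ≤ (ρ a).re := by
  have hρc : Continuous ρ := LinearMap.continuous_of_finiteDimensional ρ
  have hcpt : IsCompact {a : Matrix (Fin n) (Fin n) ℂ | a.PosSemidef ∧ a.trace.re = 1} := by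
    refine (isCompact_setOf_norm_entry_le 1).of_isClosed_subset
      (isClosed_setOf_posSemidef.inter (isClosed_eq (by fun_prop) continuous_const)) ?_
    rintro a ⟨ha, ha1⟩ i j
    exact (norm_entry_le_re_trace ha i j).trans_eq ha1
  obtain ⟨c, hc, hle⟩ := hcpt.exists_forall_le' (f := fun a => (ρ a).re) (a := 0) (by fun_prop) (by
    rintro a ⟨ha, ha1⟩
    refine (Complex.pos_iff.mp (hρ.2 a ha ?_)).1
    rintro rfl
    simp at ha1)
  refine ⟨c, hc, fun a ha => ?_⟩
  have htr := Complex.nonneg_iff.mp ha.trace_nonneg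
  rcases htr.1.eq_or_lt with h0 | hpos
  · have : a = 0 := ha.trace_eq_zero_iff.mp (Complex.ext h0.symm htr.2.symm)
    simp [this]
  · have := hle ((a.trace.re⁻¹ : ℝ) • a) ⟨ha.smul (by positivity), by
      simp [Matrix.trace_smul, hpos.ne']⟩
    have hρs : ρ ((a.trace.re⁻¹ : ℝ) • a) = (a.trace.re⁻¹ : ℝ) • ρ a := by
      rw [← Complex.coe_smul, map_smul, Complex.coe_smul]
    rw [hρs, Complex.smul_re, smul_eq_mul, inv_mul_eq_div, le_div_iff₀ hpos] at this
    exact this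

section Cone

variable {m n : ℕ} {ρ : Matrix (Fin n) (Fin n) ℂ →ₗ[ℂ] ℂ}

theorem sliceMap_add {l : ℕ} (y z : Mat m n (l + 1)) :
    sliceMap ρ (y + z) = sliceMap ρ y + sliceMap ρ z := by
  ext pi qj
  exact map_add ρ (Matrix.of fun s t => y (pi.1, Fin.snoc pi.2 s) (qj.1, Fin.snoc qj.2 t))
    (Matrix.of fun s t => z (pi.1, Fin.snoc pi.2 s) (qj.1, Fin.snoc qj.2 t))

theorem sliceMap_smul {l : ℕ} (r : ℝ) (y : Mat m n (l + 1)) :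
    sliceMap ρ (r • y) = r • sliceMap ρ y := by
  ext pi qj
  exact LinearMap.map_smul_of_tower ρ r
    (Matrix.of fun s t => y (pi.1, Fin.snoc pi.2 s) (qj.1, Fin.snoc qj.2 t))

theorem continuous_sliceMap {l : ℕ} :
    Continuous (sliceMap ρ : Mat m n (l + 1) → Mat m n l) := by
  have hρc : Continuous ρ := LinearMap.continuous_of_finiteDimensional ρ
  refine continuous_pi fun pi => continuous_pi fun qj => hρc.comp ?_
  exact continuous_pi fun s => continuous_pi fun t => continuous_apply_apply _ _

theorem re_trace_sliceMap_ge {c : ℝ}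
    (hc : ∀ a : Matrix (Fin n) (Fin n) ℂ, a.PosSemidef → c * a.trace.re ≤ (ρ a).re)
    {l : ℕ} {y : Mat m n (l + 1)} (hy : y.PosSemidef) :
    c * y.trace.re ≤ (sliceMap ρ y).trace.re := by
  have htr : y.trace = ∑ pi : Fin m × (Fin l → Fin n),
      (y.submatrix (fun s : Fin n => (pi.1, (Fin.snoc pi.2 s : Fin (l + 1) → Fin n)))
        (fun s => (pi.1, Fin.snoc pi.2 s))).trace := by
    simp only [Matrix.trace, Matrix.diag_apply, Matrix.submatrix_apply, Fintype.sum_prod_type]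
    refine Finset.sum_congr rfl fun p _ => ?_
    rw [← (Fin.snocEquiv fun _ => Fin n).sum_comp, Fintype.sum_prod_type_right]
    rfl
  rw [htr, Complex.re_sum, Finset.mul_sum, Matrix.trace, Complex.re_sum]
  exact Finset.sum_le_sum fun pi _ => hc _ (hy.submatrix _)

theorem smul_mem_Kcone {y : ∀ l, Mat m n l} (hy : y ∈ Kcone m n ρ) {r : ℝ} (hr : 0 ≤ r) :
    r • y ∈ Kcone m n ρ := by
  refine ⟨fun l => (hy.1 l).smul hr, fun l σ p q i j => ?_, fun l => ?_⟩
  · exact congrArg (r • ·) (hy.2.1 l σ p q i j)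
  · rw [Pi.smul_apply, Pi.smul_apply, sliceMap_smul, ← smul_sub]
    exact (hy.2.2 l).smul hr

theorem add_mem_Kcone {y z : ∀ l, Mat m n l} (hy : y ∈ Kcone m n ρ) (hz : z ∈ Kcone m n ρ) :
    y + z ∈ Kcone m n ρ := by
  refine ⟨fun l => (hy.1 l).add (hz.1 l), fun l σ p q i j => ?_, fun l => ?_⟩
  · exact congrArg₂ (· + ·) (hy.2.1 l σ p q i j) (hz.2.1 l σ p q i j)
  · rw [Pi.add_apply, Pi.add_apply, sliceMap_add, add_sub_add_comm]
    exact (hy.2.2 l).add (hz.2.2 l)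

theorem isClosed_Kcone : IsClosed (Kcone m n ρ) := by
  simp only [Kcone, SymInvariant, Set.ofPred_and, Set.ofPred_forall]
  refine IsClosed.inter ?_ (IsClosed.inter ?_ ?_)
  · exact isClosed_iInter fun l =>
      (isClosed_setOf_posSemidef (ι := Fin m × (Fin l → Fin n))).preimage
        (continuous_apply (A := fun l => Mat m n l) l)
  · refine isClosed_iInter fun l => isClosed_iInter fun σ => isClosed_iInter fun p =>
      isClosed_iInter fun q => isClosed_iInter fun i => isClosed_iInter fun j => ?_
    exact isClosed_eq ((continuous_apply_apply _ _).comp (continuous_apply l))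
      ((continuous_apply_apply _ _).comp (continuous_apply l))
  · exact isClosed_iInter fun l => isClosed_setOf_posSemidef.preimage
      ((continuous_apply l).sub (continuous_sliceMap.comp (continuous_apply (l + 1))))

/-- The real part of the trace of the component of degree zero. -/
noncomputable def traceZero (m n : ℕ) : (∀ l : ℕ, Mat m n l) →ₗ[ℝ] ℝ where
  toFun y := (y 0).trace.re
  map_add' y z := by simp
  map_smul' r y := by simp [Matrix.trace_smul]

theorem continuous_traceZero : Continuous (traceZero m n) :=
  Complex.continuous_re.comp (Continuous.matrix_trace (continuous_apply 0))

theorem re_trace_le_of_mem_Kcone {c : ℝ} (hc0 : 0 < c)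
    (hc : ∀ a : Matrix (Fin n) (Fin n) ℂ, a.PosSemidef → c * a.trace.re ≤ (ρ a).re)
    {y : ∀ l, Mat m n l} (hy : y ∈ Kcone m n ρ) (l : ℕ) :
    (y l).trace.re ≤ traceZero m n y / c ^ l := by
  induction l with
  | zero => simp [traceZero]
  | succ l ih =>
    have h1 := re_trace_sliceMap_ge hc (hy.1 (l + 1))
    have h2 := (Complex.nonneg_iff.mp (hy.2.2 l).trace_nonneg).1
    rw [Matrix.trace_sub, Complex.sub_re] at h2
    rw [pow_succ, ← div_div, le_div_iff₀ hc0]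
    linarith

theorem traceZero_pos (hρ : IsFaithfulPosLF ρ) {y : ∀ l, Mat m n l} (hy : y ∈ Kcone m n ρ)
    (hy0 : y ≠ 0) : 0 < traceZero m n y := by
  obtain ⟨c, hc0, hc⟩ := exists_mul_re_trace_le hρ
  refine (Complex.nonneg_iff.mp (hy.1 0).trace_nonneg).1.lt_of_ne fun h => hy0 ?_
  have h0 : traceZero m n y = 0 := h.symm
  funext l
  ext p q
  have := (norm_entry_le_re_trace (hy.1 l) p q).trans (re_trace_le_of_mem_Kcone hc0 hc hy l)
  rw [h0, zero_div] at this
  simpa using this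

theorem isCompact_Kcone_slice (hρ : IsFaithfulPosLF ρ) (r : ℝ) :
    IsCompact {y | y ∈ Kcone m n ρ ∧ traceZero m n y = r} := by
  obtain ⟨c, hc0, hc⟩ := exists_mul_re_trace_le hρ
  refine (isCompact_univ_pi fun l => isCompact_setOf_norm_entry_le (r / c ^ l)).of_isClosed_subset
    (isClosed_Kcone.inter (isClosed_eq continuous_traceZero continuous_const)) ?_
  rintro y ⟨hy, rfl⟩ l - p q
  exact (norm_entry_le_re_trace (hy.1 l) p q).trans (re_trace_le_of_mem_Kcone hc0 hc hy l)

theorem convex_Kcone_slice (r : ℝ) :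
    Convex ℝ {y | y ∈ Kcone m n ρ ∧ traceZero m n y = r} := by
  rintro y ⟨hy, hyr⟩ z ⟨hz, hzr⟩ a b ha hb hab
  refine ⟨add_mem_Kcone (smul_mem_Kcone hy ha) (smul_mem_Kcone hz hb), ?_⟩
  rw [map_add, map_smul, map_smul, hyr, hzr, ← add_smul, hab, one_smul]

end Cone

instance {ι : Type*} : LocallyConvexSpace ℝ (Matrix ι ι ℂ) :=
  inferInstanceAs (LocallyConvexSpace ℝ (ι → ι → ℂ))

instance {m n l : ℕ} : SecondCountableTopology (Mat m n l) :=
  inferInstanceAs (SecondCountableTopology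
    (Fin m × (Fin l → Fin n) → Fin m × (Fin l → Fin n) → ℂ))

instance {m n l : ℕ} : BorelSpace (Mat m n l) := ⟨rfl⟩

theorem stmt2 (m n : ℕ) (hm : 0 < m) (hn : 0 < n)
    (ρ : Matrix (Fin n) (Fin n) ℂ →ₗ[ℂ] ℂ) (hρ : IsFaithfulPosLF ρ)
    (x : ∀ l : ℕ, Mat m n l) (hx : x ∈ Kcone m n ρ) (hx0 : x ≠ 0) :
    ∃ μ : MeasureTheory.Measure (∀ l : ℕ, Mat m n l),
      MeasureTheory.IsProbabilityMeasure μ ∧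
      (∀ f : (∀ l : ℕ, Mat m n l) →L[ℝ] ℝ, f x = ∫ y, f y ∂μ) ∧
      (∀ F : Set (∀ l : ℕ, Mat m n l), IsClosed F → F ⊆ Kcone m n ρ →
        exr (Kcone m n ρ) ⊆ F → μ F = 1) := by
  obtain ⟨μ, hμ, hrep, hsupp⟩ := exists_representing_measure
    (isCompact_Kcone_slice hρ (traceZero m n x)) (convex_Kcone_slice _) ⟨hx, rfl⟩
  refine ⟨μ, hμ, hrep, fun F hF _ hexr => le_antisymm MeasureTheory.prob_le_one ?_⟩
  rw [← hsupp]
  refine MeasureTheory.measure_mono (closure_minimal (Set.Subset.trans ?_ hexr) hF)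
  exact extremePoints_slice_subset_exr (fun y hy r hr => smul_mem_Kcone hy hr) (traceZero m n)
    (fun y hy hy0 => traceZero_pos hρ hy hy0) (traceZero_pos hρ hx hx0)

end DeFinetti
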